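/- Assume (f₀), (i₀), (i₁), (i₂), and let N* be a positive ω-periodic solution of the impulsive Lasota–Wazewska equation (LW). For t ≥ 0, 1 ≤ i ≤ n and a piecewise continuous function φ : [−τ_i(t),0] → ℝ with φ(θ) ≥ −N*(t+θ) for all θ ∈ [−τ_i(t),0], set f_i(t,φ) := b_i(t)·e^{−β_i(t)·N*(t−τ_i(t))}·(e^{−β_i(t)·φ(−τ_i(t))} − 1). Then −λ_{1,i}(t)·M_t^i(φ) ≤ f_i(t,φ) ≤ λ_{2,i}(t)·M_t^i(−φ), where λ_{1,i}(t) := β_i(t)·b_i(t)·e^{−β_i(t)·N*(t−τ_i(t))}, λ_{2,i}(t) := β_i(t)·b_i(t), and M_t^i(ψ) := max{0, sup_{θ∈[−τ_i(t),0]} ψ(θ)}. -/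

import Mathlib

open Filter Set

noncomputable section

/-- `τ̄ = max_{i,t} τ_i(t)`. -/
def taubar {n : ℕ} (τi : Fin (n + 1) → ℝ → ℝ) : ℝ :=
  sSup {x : ℝ | ∃ i : Fin (n + 1), ∃ t : ℝ, τi i t = x}

/-- A positive solution of the impulsive Lasota–Wazewska equation (LW) on `[t₀,∞)`. -/
def IsPosSolLW {n : ℕ} (a : ℝ → ℝ) (b β τi : Fin (n + 1) → ℝ → ℝ)
    (tk : ℕ → ℝ) (I : ℕ → ℝ → ℝ) (t₀ : ℝ) (N : ℝ → ℝ) : Prop :=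
  ContinuousOn N (Set.Icc (t₀ - taubar τi) t₀) ∧
  (∀ t ∈ Set.Icc (t₀ - taubar τi) t₀, 0 < N t) ∧
  (∀ t > t₀, 0 < N t) ∧
  (∀ t > t₀, ContinuousWithinAt N (Set.Iic t) t) ∧
  (∀ t > t₀, ∃ L, Tendsto N (nhdsWithin t (Set.Ioi t)) (nhds L)) ∧
  (∀ t > t₀, (∀ k, t ≠ tk k) → ContinuousAt N t) ∧
  (∀ t > t₀, DifferentiableWithinAt ℝ N (Set.Iic t) t) ∧
  (∀ t > t₀, (∀ k, t ≠ tk k) →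
    derivWithin N (Set.Iic t) t + a t * N t =
      ∑ i, b i t * Real.exp (-(β i t * N (t - τi i t)))) ∧
  (∀ k, tk k > t₀ →
    Tendsto N (nhdsWithin (tk k) (Set.Ioi (tk k))) (nhds (N (tk k) + I k (N (tk k)))))

/-- Yorke's functional `M_t^i(ψ) = max{0, sup_{θ ∈ [−r,0]} ψ(θ)}`. -/
def yorkeM (r : ℝ) (ψ : ℝ → ℝ) : ℝ := max 0 (sSup (ψ '' Set.Icc (-r) 0))

/-- Piecewise continuity on a set: finitely many discontinuities. -/
def PcwContOn (g : ℝ → ℝ) (s : Set ℝ) : Prop :=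
  {x ∈ s | ¬ ContinuousWithinAt g s x}.Finite

theorem le_yorkeM {r M : ℝ} {ψ : ℝ → ℝ} (hM : ∀ θ ∈ Set.Icc (-r) 0, ψ θ ≤ M) {θ : ℝ}
    (hθ : θ ∈ Set.Icc (-r) 0) : ψ θ ≤ yorkeM r ψ :=
  (le_csSup ⟨M, forall_mem_image.2 hM⟩ (mem_image_of_mem ψ hθ)).trans (le_max_right _ _)

theorem yorkeM_nonneg (r : ℝ) (ψ : ℝ → ℝ) : 0 ≤ yorkeM r ψ := le_max_left _ _

theorem exp_neg_mul_exp_neg_sub_one_le {x y m : ℝ} (hxy : 0 ≤ x + y) (hm : 0 ≤ m)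
    (hym : -y ≤ m) : Real.exp (-x) * (Real.exp (-y) - 1) ≤ m := by
  rcases le_total 0 y with hy | hy
  · have h : Real.exp (-y) ≤ 1 := Real.exp_le_one_iff.2 (by linarith)
    exact (mul_nonpos_of_nonneg_of_nonpos (Real.exp_pos _).le (by linarith)).trans hm
  · have h₁ : Real.exp (-(x + y)) ≤ 1 := Real.exp_le_one_iff.2 (by linarith)
    have h₂ : 1 - Real.exp y ≤ -y := by linarith [Real.add_one_le_exp y]
    have h₃ : Real.exp y ≤ 1 := Real.exp_le_one_iff.2 hy
    calc Real.exp (-x) * (Real.exp (-y) - 1)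
        = Real.exp (-(x + y)) * (1 - Real.exp y) := by
          rw [mul_sub, mul_sub, ← Real.exp_add, ← Real.exp_add]
          ring_nf
      _ ≤ 1 * (1 - Real.exp y) := mul_le_mul_of_nonneg_right h₁ (by linarith)
      _ ≤ m := by linarith

theorem lemma33_yorke_bounds_for_LW {n : ℕ}
    (ω : ℝ) (hω : 0 < ω) (p : ℕ) (hp : 0 < p)
    (a : ℝ → ℝ) (b β τi : Fin (n + 1) → ℝ → ℝ) (tk : ℕ → ℝ) (I : ℕ → ℝ → ℝ)
    -- (f₀)
    (ha : Continuous a ∧ (∀ t, 0 < a t) ∧ Function.Periodic a ω)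
    (hb : ∀ i, Continuous (b i) ∧ (∀ t, 0 < b i t) ∧ Function.Periodic (b i) ω)
    (hβ : ∀ i, Continuous (β i) ∧ (∀ t, 0 < β i t) ∧ Function.Periodic (β i) ω)
    (hτ : ∀ i, Continuous (τi i) ∧ (∀ t, 0 < τi i t) ∧ Function.Periodic (τi i) ω)
    -- (i₀)
    (htk_mono : StrictMono tk) (htk0 : ∀ k < p, 0 < tk k ∧ tk k < ω)
    (htk_per : ∀ k, tk (k + p) = tk k + ω)
    (hI_cont : ∀ k, ContinuousOn (I k) (Set.Ici 0))
    (hI_pos : ∀ k, ∀ u > (0:ℝ), 0 < u + I k u)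
    (hI_per : ∀ k, I (k + p) = I k)
    -- (i₁), with (a_k), (b_k) extended p-periodically
    (aa bb : ℕ → ℝ) (haa_per : ∀ k, aa (k + p) = aa k) (hbb_per : ∀ k, bb (k + p) = bb k)
    (hbb : ∀ k, -1 < bb k)
    (hi1 : ∀ k, ∀ x y : ℝ, 0 ≤ x → 0 ≤ y → x ≠ y →
      bb k ≤ (I k x - I k y) / (x - y) ∧ (I k x - I k y) / (x - y) ≤ aa k)
    -- (i₂)
    (hi2 : ∏ k ∈ Finset.range p, (1 + aa k) ≤ 1)
    -- the positive ω-periodic solution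
    (Nstar : ℝ → ℝ) (hNstar : IsPosSolLW a b β τi tk I 0 Nstar)
    (hNper : ∀ t, Nstar (t + ω) = Nstar t) :
    ∀ i : Fin (n + 1), ∀ t ≥ (0:ℝ), ∀ φ : ℝ → ℝ,
      PcwContOn φ (Set.Icc (-τi i t) 0) →
      (∃ M, ∀ θ ∈ Set.Icc (-τi i t) 0, |φ θ| ≤ M) →
      (∀ θ ∈ Set.Icc (-τi i t) 0, -Nstar (t + θ) ≤ φ θ) →
      -(β i t * b i t * Real.exp (-(β i t * Nstar (t - τi i t)))) *
          yorkeM (τi i t) φ ≤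
        b i t * Real.exp (-(β i t * Nstar (t - τi i t))) *
          (Real.exp (-(β i t * φ (-τi i t))) - 1) ∧
      b i t * Real.exp (-(β i t * Nstar (t - τi i t))) *
          (Real.exp (-(β i t * φ (-τi i t))) - 1) ≤
        β i t * b i t * yorkeM (τi i t) (fun θ => -φ θ) := by
  rintro i t - φ - ⟨M, hM⟩ hφ
  have hb₀ := (hb i).2.1 t
  have hβ₀ := (hβ i).2.1 t
  have hmem : -τi i t ∈ Set.Icc (-τi i t) 0 := ⟨le_rfl, by linarith [(hτ i).2.1 t]⟩
  have hN : -Nstar (t - τi i t) ≤ φ (-τi i t) := by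
    simpa only [← sub_eq_add_neg] using hφ _ hmem
  have hsup : φ (-τi i t) ≤ yorkeM (τi i t) φ :=
    le_yorkeM (fun θ hθ => (abs_le.1 (hM θ hθ)).2) hmem
  have hsup_neg : -φ (-τi i t) ≤ yorkeM (τi i t) (fun θ => -φ θ) :=
    le_yorkeM (ψ := fun θ => -φ θ) (M := M)
      (fun θ hθ => by linarith [(abs_le.1 (hM θ hθ)).1]) hmem
  constructor
  · have h : -(β i t * yorkeM (τi i t) φ) ≤ Real.exp (-(β i t * φ (-τi i t))) - 1 := by
      linarith [Real.add_one_le_exp (-(β i t * φ (-τi i t))),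
        mul_le_mul_of_nonneg_left hsup hβ₀.le]
    refine le_trans (le_of_eq ?_) (mul_le_mul_of_nonneg_left h
      (mul_pos hb₀ (Real.exp_pos (-(β i t * Nstar (t - τi i t))))).le)
    ring
  · have h := exp_neg_mul_exp_neg_sub_one_le
      (x := β i t * Nstar (t - τi i t)) (y := β i t * φ (-τi i t))
      (m := β i t * yorkeM (τi i t) (fun θ => -φ θ))
      (by rw [← mul_add]; exact mul_nonneg hβ₀.le (by linarith))
      (mul_nonneg hβ₀.le (yorkeM_nonneg _ _))
      (by rw [← mul_neg]; exact mul_le_mul_of_nonneg_left hsup_neg hβ₀.le)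
    linarith [mul_le_mul_of_nonneg_left h hb₀.le]
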